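/- arXiv:2210.08776 — 2 statements merged into one kernel-verified Lean document; each statement's English description precedes it below -/
import Mathlib

section
/- Let n ≥ 2 be an integer and let A be a 2-torsion-free unital ring. If Φ : A → A is a multiplicative Jordan n-centralizer and μ = Φ(1), then 2Φ(t) = μ∘t = μt + tμ for all t ∈ A. -/
/-- The Jordan `n`-product `qₙ(t₁,…,tₙ)`, folding the Jordan product `a∘b = ab + ba`
from the left: `q₁(t₁) = t₁`, `qₙ(t₁,…,tₙ) = qₙ₋₁(t₁,…,tₙ₋₁)∘tₙ`. -/
def jordanProd {A : Type*} [Ring A] : List A → A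
  | [] => 0
  | t :: ts => ts.foldl (fun x y => x * y + y * x) t

/-- A map `Φ` (not assumed additive) is a multiplicative Jordan `n`-centralizer if
`Φ(qₙ(t₁,t₂,…,tₙ)) = qₙ(Φ(t₁),t₂,…,tₙ)` for all `t₁,…,tₙ`. -/
def IsMulJordanCentralizer {A : Type*} [Ring A] (n : ℕ) (Φ : A → A) : Prop :=
  ∀ l : List A, l.length = n →
    Φ (jordanProd l) = jordanProd (l.set 0 (Φ (l.getD 0 0)))

theorem foldl_jordan_replicate_one {A : Type*} [Ring A] (k : ℕ) (x : A) :
    (List.replicate k (1 : A)).foldl (fun x y => x * y + y * x) x = 2 ^ k * x := by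
  induction k generalizing x with
  | zero => simp
  | succ k ih => rw [List.replicate_succ, List.foldl_cons, ih, pow_succ]; simp [mul_assoc, two_mul]

theorem eq_of_two_pow_mul_eq {A : Type*} [Ring A] (h2 : ∀ t : A, 2 * t = 0 → t = 0)
    (k : ℕ) {x y : A} (h : 2 ^ k * x = 2 ^ k * y) : x = y := by
  induction k with
  | zero => simpa using h
  | succ k ih =>
    refine ih (sub_eq_zero.mp (h2 _ ?_))
    rw [mul_sub, ← mul_assoc, ← mul_assoc, ← pow_succ', h, sub_self]

/-- For a multiplicative Jordan `n`-centralizer `Φ` on a 2-torsion-free unital ring,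
with `μ = Φ(1)`, one has `2Φ(t) = μ∘t = μt + tμ`. -/
theorem stmt_2 {A : Type*} [Ring A] (n : ℕ) (hn : 2 ≤ n)
    (h2 : ∀ t : A, 2 * t = 0 → t = 0)
    (Φ : A → A) (hΦ : IsMulJordanCentralizer n Φ) :
    ∀ t : A, 2 * Φ t = Φ 1 * t + t * Φ 1 := by
  intro t
  obtain ⟨k, rfl⟩ := Nat.exists_eq_add_of_le' hn
  have h₁ := hΦ (1 :: t :: List.replicate k 1) (by simp)
  have h₂ := hΦ (t :: 1 :: List.replicate k 1) (by simp)
  simp only [jordanProd, List.set_cons_zero, List.getD_cons_zero, List.foldl_cons,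
    foldl_jordan_replicate_one, one_mul, mul_one] at h₁ h₂
  refine eq_of_two_pow_mul_eq h2 k ?_
  rw [two_mul, ← h₂, h₁]
end

section
/- Let n ≥ 2 be an integer and let A be a 2-torsion-free unital ring (2t = 0 implies t = 0) containing a nontrivial idempotent e₁ (e₁ ≠ 0 and e₁ ≠ 1), write e₂ = 1 − e₁, and assume A satisfies condition (♠). Then every multiplicative generalized Jordan n-derivation Δ : A → A is of the form Δ(t) = μt + d(t) + φ(t) for all t ∈ A, where μ lies in the center Z(A), d : A → A is a derivation, and φ : A → A is a singular Jordan derivation. -/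
/-- A map `δ` (not assumed additive) is a multiplicative Jordan `n`-derivation if
`δ(qₙ(t₁,…,tₙ)) = Σᵢ qₙ(t₁,…,δ(tᵢ),…,tₙ)` for all `t₁,…,tₙ`. -/
def IsMulJordanDeriv {A : Type*} [Ring A] (n : ℕ) (δ : A → A) : Prop :=
  ∀ l : List A, l.length = n →
    δ (jordanProd l) = ∑ i ∈ Finset.range n, jordanProd (l.set i (δ (l.getD i 0)))

/-- A map `Δ` is a multiplicative generalized Jordan `n`-derivation (with associated
multiplicative Jordan `n`-derivation `δ`). -/
def IsMulGenJordanDeriv {A : Type*} [Ring A] (n : ℕ) (Δ δ : A → A) : Prop :=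
  ∀ l : List A, l.length = n →
    Δ (jordanProd l) = jordanProd (l.set 0 (Δ (l.getD 0 0)))
      + ∑ i ∈ Finset.Ico 1 n, jordanProd (l.set i (δ (l.getD i 0)))

/-- Condition (♠) for a unital ring with idempotent `e₁` (and `e₂ = 1 - e₁`). -/
def Spade {A : Type*} [Ring A] (e₁ : A) : Prop :=
  (∀ t : A, (∀ a : A, e₁ * t * e₁ * (e₁ * a * (1 - e₁)) = 0 ∧
      ((1 - e₁) * a * e₁) * (e₁ * t * e₁) = 0) → e₁ * t * e₁ = 0) ∧
  (∀ t : A, (∀ a : A, (e₁ * a * (1 - e₁)) * ((1 - e₁) * t * (1 - e₁)) = 0 ∧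
      ((1 - e₁) * t * (1 - e₁)) * ((1 - e₁) * a * e₁) = 0) →
      (1 - e₁) * t * (1 - e₁) = 0)

/-- A singular Jordan derivation relative to the idempotent `e₁`: an additive Jordan
derivation `φ` with `φ(e₁Ae₁) = {0}`, `φ(e₁Ae₂) ⊆ e₂Ae₁`, `φ(e₂Ae₁) ⊆ e₁Ae₂`,
`φ(e₂Ae₂) = {0}`, where `e₂ = 1 - e₁`. -/
def IsSingularJordanDeriv {A : Type*} [Ring A] (e₁ : A) (φ : A → A) : Prop :=
  (∀ x y : A, φ (x + y) = φ x + φ y) ∧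
  (∀ x y : A, φ (x * y + y * x) = φ x * y + y * φ x + x * φ y + φ y * x) ∧
  (∀ a : A, φ (e₁ * a * e₁) = 0) ∧
  (∀ a : A, ∃ b : A, φ (e₁ * a * (1 - e₁)) = (1 - e₁) * b * e₁) ∧
  (∀ a : A, ∃ b : A, φ ((1 - e₁) * a * e₁) = e₁ * b * (1 - e₁)) ∧
  (∀ a : A, φ ((1 - e₁) * a * (1 - e₁)) = 0)

set_option linter.unusedSimpArgs false

/-- Complementary idempotents in a `2`-torsion-free ring satisfying the faithfulness condition. -/
structure Peirce {A : Type*} [Ring A] (e f : A) : Prop where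
  add_eq : e + f = 1
  ee : e * e = e
  ff : f * f = f
  ef : e * f = 0
  fe : f * e = 0
  two : ∀ t : A, t + t = 0 → t = 0
  faithful₁ : ∀ t : A, (∀ a, e * t * e * a * f = 0) → (∀ a, f * a * e * t * e = 0) → e * t * e = 0
  faithful₂ : ∀ t : A, (∀ a, f * t * f * a * e = 0) → (∀ a, e * a * f * t * f = 0) → f * t * f = 0

namespace Peirce

variable {A : Type*} [Ring A] {e f : A}

theorem symm (h : Peirce e f) : Peirce f e :=
  ⟨by rw [add_comm]; exact h.add_eq, h.ff, h.ee, h.fe, h.ef, h.two, h.faithful₂, h.faithful₁⟩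

theorem two_inj (h : Peirce e f) {s t : A} (H : s + s = t + t) : s = t := by
  rw [← sub_eq_zero]
  apply h.two
  linear_combination (norm := abel) H

theorem ee' (h : Peirce e f) (x : A) : e * (e * x) = e * x := by rw [← mul_assoc, h.ee]
theorem ff' (h : Peirce e f) (x : A) : f * (f * x) = f * x := h.symm.ee' x
theorem ef' (h : Peirce e f) (x : A) : e * (f * x) = 0 := by rw [← mul_assoc, h.ef, zero_mul]
theorem fe' (h : Peirce e f) (x : A) : f * (e * x) = 0 := h.symm.ef' x

/-- The multiplication rules of the two idempotents, for use as a `simp` set. -/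
theorem rules (h : Peirce e f) : e * e = e ∧ f * f = f ∧ e * f = 0 ∧ f * e = 0 ∧
    (∀ x, e * (e * x) = e * x) ∧ (∀ x, f * (f * x) = f * x) ∧ (∀ x, e * (f * x) = 0) ∧
    (∀ x, f * (e * x) = 0) :=
  ⟨h.ee, h.ff, h.ef, h.fe, h.ee', h.ff', h.ef', h.fe'⟩

theorem decomp (h : Peirce e f) (x : A) :
    x = e * x * e + e * x * f + f * x * e + f * x * f := by
  calc x = (e + f) * x * (e + f) := by rw [h.add_eq, one_mul, mul_one]
    _ = _ := by simp only [mul_add, add_mul]; abel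

/-- Elements with equal Peirce components are equal. -/
theorem ext (h : Peirce e f) {x y : A} (h₁ : e * x * e = e * y * e) (h₂ : e * x * f = e * y * f)
    (h₃ : f * x * e = f * y * e) (h₄ : f * x * f = f * y * f) : x = y := by
  rw [h.decomp x, h.decomp y, h₁, h₂, h₃, h₄]

theorem mul_offdiag (h : Peirce e f) {z : A} (hz : f * z * e = 0) (a : A) :
    z * (e * a * f) = e * (z * (e * (a * f))) := by
  rw [mul_assoc] at hz
  rw [← one_mul (z * _), ← h.add_eq, add_mul]
  simp only [← mul_assoc] at hz ⊢
  simp only [hz, zero_mul, add_zero]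

theorem offdiag_mul (h : Peirce e f) {z : A} (hz : f * z * e = 0) (a : A) :
    e * a * f * z = e * (a * (f * (z * f))) := by
  rw [← mul_one (_ * z), ← h.add_eq, mul_add]
  simp only [mul_assoc] at hz ⊢
  simp only [hz, mul_zero, zero_add]

theorem comm_corner (h : Peirce e f) {z : A}
    (h₁ : ∀ a, z * (e * a * f) = e * a * f * z) (h₂ : ∀ a, z * (f * a * e) = f * a * e * z)
    (a : A) : e * (z * (e * a * e) - e * a * e * z) * e = 0 := by
  have k₁ : ∀ x, e * (z * (e * (x * f))) = e * (x * (f * (z * f))) := fun x => by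
    have := congrArg (fun t => e * t * f) (h₁ x)
    simpa only [mul_assoc, h.ee', h.ff] using this
  have k₂ : ∀ x, f * (z * (f * (x * e))) = f * (x * (e * (z * e))) := fun x => by
    have := congrArg (fun t => f * t * e) (h₂ x)
    simpa only [mul_assoc, h.ff', h.ee] using this
  apply h.faithful₁
  · intro b
    have l₁ := k₁ (a * e * b)
    have l₂ := congrArg (fun t => e * a * t) (k₁ b)
    simp only [mul_assoc, mul_sub, sub_mul, h.ee', h.ee] at l₁ l₂ ⊢
    rw [l₁, l₂, sub_self]
  · intro b
    have l₁ := k₂ (b * e * a)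
    have l₂ := congrArg (fun t => t * a * e) (k₂ b)
    simp only [mul_assoc, mul_sub, sub_mul, h.ee', h.ee] at l₁ l₂ ⊢
    rw [← l₁, ← l₂, sub_self]

/-- An element without off-diagonal components that commutes with the off-diagonal corners is
central. -/
theorem central (h : Peirce e f) {z : A} (h₁₂ : e * z * f = 0) (h₂₁ : f * z * e = 0)
    (h₁ : ∀ a, z * (e * a * f) = e * a * f * z) (h₂ : ∀ a, z * (f * a * e) = f * a * e * z)
    (a : A) : z * a = a * z := by
  have k₁ := h.comm_corner h₁ h₂ a
  have k₂ := h.symm.comm_corner h₂ h₁ a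
  have d := h.decomp z
  rw [h₁₂, h₂₁, add_zero, add_zero] at d
  have ez : e * z = z * e := by
    rw [d]; simp only [mul_add, add_mul, mul_assoc, h.ee, h.ee', h.ef', h.fe, mul_zero]
  have fz : f * z = z * f := by
    rw [d]; simp only [mul_add, add_mul, mul_assoc, h.ff, h.ff', h.fe', h.ef, mul_zero]
  have m₁ : z * (e * a * e) = e * a * e * z := by
    rw [← sub_eq_zero, ← k₁]
    simp only [mul_sub, sub_mul]
    rw [← mul_assoc e z, ez]
    simp only [mul_assoc, h.ee, h.ee']
    rw [← ez, h.ee', ez]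
  have m₂ : z * (f * a * f) = f * a * f * z := by
    rw [← sub_eq_zero, ← k₂]
    simp only [mul_sub, sub_mul]
    rw [← mul_assoc f z, fz]
    simp only [mul_assoc, h.ff, h.ff']
    rw [← fz, h.ff', fz]
  rw [h.decomp a, mul_add, mul_add, mul_add, m₁, m₂, h₁, h₂, add_mul, add_mul, add_mul]

end Peirce

theorem foldl_jordan_ones {A : Type*} [Ring A] (k : ℕ) (z : A) :
    (List.replicate k (1 : A)).foldl (fun x y => x * y + y * x) z = 2 ^ k • z := by
  induction k generalizing z with
  | zero => simp
  | succ k ih =>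
    rw [List.replicate_succ, List.foldl_cons, ih, mul_one, one_mul, ← two_nsmul, smul_smul,
      pow_succ]

theorem foldl_jordan_set {A : Type*} [Ring A] (c : A) (k j : ℕ) (hj : j < k) (z : A) :
    2 • ((List.replicate k (1 : A)).set j c).foldl (fun x y => x * y + y * x) z =
      2 ^ k • (z * c + c * z) := by
  induction k generalizing z j with
  | zero => omega
  | succ k ih =>
    rw [List.replicate_succ]
    cases j with
    | zero => rw [List.set_cons_zero, List.foldl_cons, foldl_jordan_ones, smul_smul, pow_succ']
    | succ j =>
      rw [List.set_cons_succ, List.foldl_cons, ih j (by omega), pow_succ]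
      simp only [mul_one, one_mul, ← two_nsmul, mul_smul, smul_mul_assoc, mul_smul_comm, smul_add]

theorem gen_two_mul {A : Type*} [Ring A] {k : ℕ} {Δ δ : A → A}
    (h : IsMulGenJordanDeriv (k + 2) Δ δ) (x y : A) :
    2 • Δ (2 ^ k • (x * y + y * x)) =
      2 • 2 ^ k • (Δ x * y + y * Δ x + (x * δ y + δ y * x)) +
      k • 2 ^ k • ((x * y + y * x) * δ 1 + δ 1 * (x * y + y * x)) := by
  have H := h (x :: y :: List.replicate k 1) (by simp)
  rw [Finset.sum_Ico_eq_sum_range] at H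
  rw [show k + 2 - 1 = k + 1 by omega, Finset.sum_range_succ'] at H
  have hs : ∀ i ∈ Finset.range k, 2 • jordanProd ((x :: y :: List.replicate k (1 : A)).set (1 + (i + 1))
      (δ ((x :: y :: List.replicate k (1 : A)).getD (1 + (i + 1)) 0))) =
      2 ^ k • ((x * y + y * x) * δ 1 + δ 1 * (x * y + y * x)) := by
    intro i hi
    rw [Finset.mem_range] at hi
    rw [show 1 + (i + 1) = i + 1 + 1 by omega, List.set_cons_succ, List.set_cons_succ,
      List.getD_cons_succ, List.getD_cons_succ, List.getD_replicate _ hi]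
    simp only [jordanProd, List.foldl_cons]
    exact foldl_jordan_set _ _ _ hi _
  rw [← add_assoc] at H
  have H2 := congrArg (fun t => 2 • t) H
  simp only [smul_add, Finset.smul_sum] at H2
  rw [Finset.sum_congr rfl hs] at H2
  simp only [jordanProd, List.foldl_cons, foldl_jordan_ones, List.set_cons_zero, List.getD_cons_zero, add_zero,
    List.set_cons_succ, List.getD_cons_succ, Finset.sum_const, Finset.card_range] at H2
  rw [H2]
  simp only [smul_add]
  abel

theorem IsMulJordanDeriv.isMulGenJordanDeriv {A : Type*} [Ring A] {n : ℕ} (hn : 2 ≤ n) {δ : A → A}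
    (h : IsMulJordanDeriv n δ) : IsMulGenJordanDeriv n δ δ := by
  intro l hl
  rw [h l hl, Finset.range_eq_Ico, Finset.sum_eq_sum_Ico_succ_bot (by omega)]

/-- The value of `Δ(x) ∘ y + x ∘ δ(y)` depends only on `x ∘ y`. -/
def JordanCompat {A : Type*} [Ring A] (Δ δ : A → A) : Prop :=
  ∀ x y x' y' : A, x * y + y * x = x' * y' + y' * x' →
    Δ x * y + y * Δ x + (x * δ y + δ y * x) = Δ x' * y' + y' * Δ x' + (x' * δ y' + δ y' * x')

theorem IsMulGenJordanDeriv.jordanCompat {A : Type*} [Ring A] {n : ℕ} (hn : 2 ≤ n) {Δ δ : A → A}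
    (two : ∀ t : A, 2 * t = 0 → t = 0) (h : IsMulGenJordanDeriv n Δ δ) : JordanCompat Δ δ := by
  obtain ⟨k, rfl⟩ := Nat.exists_eq_add_of_le' hn
  have cancel : ∀ m (t : A), 2 ^ m • t = 0 → t = 0 := by
    intro m
    induction m with
    | zero => simp
    | succ m ih =>
      intro t ht
      apply two
      rw [two_mul, ← two_nsmul]
      apply ih
      rwa [smul_smul, ← pow_succ]
  intro x y x' y' hxy
  have h₁ := gen_two_mul h x y
  have h₂ := gen_two_mul h x' y'
  rw [hxy, h₂, add_left_inj, smul_smul, smul_smul, ← pow_succ'] at h₁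
  rw [← sub_eq_zero]
  apply cancel (k + 1)
  rw [smul_sub, ← h₁, sub_self]

namespace JordanCompat

variable {A : Type*} [Ring A] {e f : A} {Δ δ : A → A}

theorem double_left (H : JordanCompat Δ δ) (x y : A) :
    Δ (x * y + y * x) + Δ (x * y + y * x) + ((x * y + y * x) * δ 1 + δ 1 * (x * y + y * x)) =
      Δ (x + x) * y + y * Δ (x + x) + ((x + x) * δ y + δ y * (x + x)) := by
  have := H (x * y + y * x) 1 (x + x) y (by noncomm_ring)
  simpa only [mul_one, one_mul] using this

theorem double (H : JordanCompat Δ δ) (x : A) :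
    Δ (x + x) + Δ (x + x) = Δ x + Δ x + (Δ x + Δ x) +
      (x * (δ (1 + 1) - (δ 1 + δ 1)) + (δ (1 + 1) - (δ 1 + δ 1)) * x) := by
  have := H (x + x) 1 x (1 + 1) (by noncomm_ring)
  simp only [mul_one, one_mul, mul_add, add_mul, mul_sub, sub_mul] at this ⊢
  linear_combination (norm := abel) this

theorem idem (H : JordanCompat Δ δ) {p : A} (hp : p * p = p) :
    Δ p * p + p * Δ p + (p * δ p + δ p * p) = Δ p + Δ p + (p * δ 1 + δ 1 * p) := by
  have := H p p p 1 (by rw [hp, mul_one, one_mul])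
  simpa only [mul_one, one_mul] using this

theorem one_offdiag (H : JordanCompat δ δ) (h : Peirce e f) : e * δ 1 * f = 0 := by
  have := congrArg (fun t => e * t * f) (H.idem h.ee)
  simp only [mul_add, add_mul, mul_assoc, h.rules, mul_zero, add_zero, zero_add] at this ⊢
  linear_combination (norm := abel) -this

theorem idem_corner₁ (H : JordanCompat δ δ) (h : Peirce e f) : e * δ e * e = e * δ 1 * e := by
  apply h.two_inj
  have := congrArg (fun t => e * t * e) (H.idem h.ee)
  simp only [mul_add, add_mul, mul_assoc, h.rules] at this ⊢
  linear_combination (norm := abel) this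

theorem idem_corner₂ (H : JordanCompat δ δ) (h : Peirce e f) : f * δ e * f = 0 := by
  apply h.two
  have := congrArg (fun t => f * t * f) (H.idem h.ee)
  simp only [mul_add, add_mul, mul_assoc, h.rules, mul_zero, add_zero, zero_add] at this ⊢
  linear_combination (norm := abel) -this

theorem defect_offdiag (H : JordanCompat δ δ) (h : Peirce e f) :
    e * (δ (1 + 1) - (δ 1 + δ 1)) * f = 0 := by
  have h₁ := congrArg (fun t => e * t * f) (H (e + e) e (e + e) 1 (by
    simp only [mul_add, add_mul, h.ee, mul_one, one_mul]))
  have h₂ := congrArg (fun t => e * t * f) (H.double e)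
  have h₃ := H.one_offdiag h
  simp only [mul_add, add_mul, mul_sub, sub_mul, mul_assoc, h.rules, mul_zero, add_zero, zero_add,
    mul_one, one_mul] at h₁ h₂ h₃ ⊢
  simp only [h₃, add_zero, sub_zero] at h₁ h₂ ⊢
  linear_combination (norm := abel) -h₁ - h₁ - h₂

theorem defect_comm (H : JordanCompat δ δ) (x y : A) :
    (δ (1 + 1) - (δ 1 + δ 1)) * (x * y - y * x) = (x * y - y * x) * (δ (1 + 1) - (δ 1 + δ 1)) := by
  have h₁ := H (x + x) y x (y + y) (by noncomm_ring)
  have h₂ := congrArg (fun t => t * y + y * t) (H.double x)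
  have h₃ := congrArg (fun t => t * x + x * t) (H.double y)
  simp only [mul_add, add_mul, mul_sub, sub_mul, mul_assoc] at h₁ h₂ h₃ ⊢
  linear_combination (norm := abel) h₁ + h₁ - h₂ + h₃

theorem defect_central (H : JordanCompat δ δ) (h : Peirce e f) (a : A) :
    (δ (1 + 1) - (δ 1 + δ 1)) * a = a * (δ (1 + 1) - (δ 1 + δ 1)) := by
  refine h.central (H.defect_offdiag h) (H.defect_offdiag h.symm) (fun a => ?_) (fun a => ?_) a
  · have := H.defect_comm e (e * a * f)
    simpa only [mul_assoc, h.rules, mul_zero, sub_zero] using this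
  · have := H.defect_comm f (f * a * e)
    simpa only [mul_assoc, h.rules, mul_zero, sub_zero] using this

theorem one_mul_corner (H : JordanCompat δ δ) (h : Peirce e f) (a : A) :
    e * a * f * δ 1 = δ 1 * (e * a * f) + (δ (1 + 1) - (δ 1 + δ 1)) * (e * a * f) ∧
    δ 1 * (f * a * e) = f * a * e * δ 1 + (δ (1 + 1) - (δ 1 + δ 1)) * (f * a * e) := by
  have hd := H.double e
  have hw := H.defect_central h
  have h₃ := H.one_offdiag h
  have h₄ := H.one_offdiag h.symm
  have hl := H.double_left e
  generalize δ (1 + 1) - (δ 1 + δ 1) = w at *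
  have hw₁ : f * w * e = 0 := by rw [mul_assoc, hw, ← mul_assoc, h.fe, zero_mul]
  have hw₂ : e * w * f = 0 := by rw [mul_assoc, hw, ← mul_assoc, h.ef, zero_mul]
  constructor
  · apply h.two_inj
    have k₁ := hl (e * a * f)
    have k₂ := congrArg (fun t => t * (e * a * f) + (e * a * f) * t) hd
    have k := congrArg (fun t => e * t * f) (congrArg₂ (· + ·) k₁ k₁)
    have k' := congrArg (fun t => e * t * f) k₂
    have h₁ := congrArg (· * (a * f)) (H.idem_corner₁ h)
    have h₂ := congrArg (e * a * ·) (H.idem_corner₂ h)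
    rw [h.mul_offdiag h₄, h.mul_offdiag hw₁, h.offdiag_mul h₄]
    simp only [mul_add, add_mul, mul_assoc, h.rules, mul_zero, add_zero, hw] at k k' h₁ h₂ ⊢
    linear_combination (norm := abel) k + k' + h₁ + h₁ + h₁ + h₁ + h₂ + h₂ + h₂ + h₂
  · apply h.two_inj
    have k₁ := hl (f * a * e)
    have k₂ := congrArg (fun t => t * (f * a * e) + (f * a * e) * t) hd
    have k := congrArg (fun t => f * t * e) (congrArg₂ (· + ·) k₁ k₁)
    have k' := congrArg (fun t => f * t * e) k₂
    have h₁ := congrArg (f * a * ·) (H.idem_corner₁ h)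
    have h₂ := congrArg (· * (a * e)) (H.idem_corner₂ h)
    rw [h.symm.mul_offdiag h₃, h.symm.mul_offdiag hw₂, h.symm.offdiag_mul h₃]
    simp only [mul_add, add_mul, mul_assoc, h.rules, zero_mul, add_zero, zero_add, hw] at k k' h₁ h₂ ⊢
    linear_combination (norm := abel) k + k' + h₁ + h₁ + h₁ + h₁ + h₂ + h₂ + h₂ + h₂

theorem defect_eq_zero (H : JordanCompat δ δ) (h : Peirce e f) :
    δ (1 + 1) - (δ 1 + δ 1) = 0 := by
  have h₁ : ∀ a, (δ (1 + 1) - (δ 1 + δ 1)) * (e * a * f) = 0 := fun a => h.two _ (by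
    linear_combination (norm := abel)
      -(H.one_mul_corner h a).1 - (H.one_mul_corner h.symm a).2)
  have h₂ : ∀ a, (δ (1 + 1) - (δ 1 + δ 1)) * (f * a * e) = 0 := fun a => h.two _ (by
    linear_combination (norm := abel)
      -(H.one_mul_corner h a).2 - (H.one_mul_corner h.symm a).1)
  have hc := H.defect_central h
  generalize δ (1 + 1) - (δ 1 + δ 1) = w at *
  have aux : ∀ p q : A, p * p = p → (∀ a, w * (p * a * q) = 0) → ∀ a, p * w * p * a * q = 0 := by
    intro p q hp hw a
    rw [← hc p, mul_assoc w, hp, mul_assoc, mul_assoc, ← mul_assoc p, hw]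
  have aux' : ∀ p q : A, p * p = p → (∀ a, w * (q * a * p) = 0) → ∀ a, q * a * p * w * p = 0 := by
    intro p q hp hw a
    rw [mul_assoc, hc p, ← mul_assoc, mul_assoc (q * a), hp, ← hc, hw]
  rw [h.decomp w, h.faithful₁ w (aux e f h.ee h₁) (aux' e f h.ee h₂),
    h.faithful₂ w (aux f e h.ff h₂) (aux' f e h.ff h₁), ← hc e, ← hc f, mul_assoc, mul_assoc, h.ef,
    h.fe]
  simp

theorem one_central (H : JordanCompat δ δ) (h : Peirce e f) (a : A) : δ 1 * a = a * δ 1 := by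
  refine h.central (H.one_offdiag h) (H.one_offdiag h.symm) (fun a => ?_) (fun a => ?_) a
  · rw [(H.one_mul_corner h a).1, H.defect_eq_zero h, zero_mul, add_zero]
  · rw [(H.one_mul_corner h a).2, H.defect_eq_zero h, zero_mul, add_zero]

theorem map_double (H : JordanCompat Δ δ) (H' : JordanCompat δ δ) (h : Peirce e f) (x : A) :
    Δ (x + x) = Δ x + Δ x := by
  have := H.double x
  rw [H'.defect_eq_zero h, mul_zero, zero_mul, add_zero, add_zero] at this
  exact h.two_inj this

theorem map_jordan (H : JordanCompat Δ δ) (H' : JordanCompat δ δ) (h : Peirce e f) (x y : A) :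
    Δ (x * y + y * x) + δ 1 * (x * y + y * x) = Δ x * y + y * Δ x + (x * δ y + δ y * x) := by
  apply h.two_inj
  have := H.double_left x y
  rw [H.map_double H' h, ← H'.one_central h] at this
  simp only [mul_add, add_mul] at this ⊢
  linear_combination (norm := abel) this

theorem map_eq (H : JordanCompat Δ δ) (H' : JordanCompat δ δ) (h : Peirce e f) (y : A) :
    Δ y + Δ y + (δ 1 * y + δ 1 * y) = Δ 1 * y + y * Δ 1 + (δ y + δ y) := by
  have := H.map_jordan H' h 1 y
  simp only [mul_one, one_mul, H.map_double H' h] at this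
  linear_combination (norm := (simp only [mul_add]; abel)) this

theorem gen_offdiag (H : JordanCompat Δ δ) (H' : JordanCompat δ δ) (h : Peirce e f) :
    e * Δ 1 * f = 0 := by
  have h₁ := congrArg (fun t => e * t * f) (H.idem h.ee)
  have h₂ := congrArg (fun t => e * t * f) (H.map_eq H' h e)
  have h₃ := H'.one_offdiag h
  simp only [mul_add, add_mul, mul_assoc, h.rules, mul_zero, add_zero, zero_add] at h₁ h₂ h₃ ⊢
  simp only [h₃, add_zero] at h₁ h₂
  linear_combination (norm := abel) -h₂ - h₁ - h₁

theorem gen_comm (H : JordanCompat Δ δ) (H' : JordanCompat δ δ) (h : Peirce e f) (x y : A) :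
    x * (Δ 1 * y - y * Δ 1) = (Δ 1 * y - y * Δ 1) * x := by
  have h₁ := H.map_jordan H' h x y
  have h₂ := H'.map_jordan H' h x y
  have h₃ := H.map_eq H' h (x * y + y * x)
  have h₄ := congrArg (fun t => t * y + y * t) (H.map_eq H' h x)
  have h₅ := H'.one_central h y
  simp only [mul_add, add_mul, mul_sub, sub_mul, mul_assoc] at h₁ h₂ h₃ h₄ ⊢
  have h₆ : y * (δ 1 * x) = δ 1 * (y * x) := by rw [← mul_assoc, ← h₅, mul_assoc]
  rw [h₆] at h₄
  linear_combination (norm := abel) h₂ + h₂ - h₁ - h₁ + h₃ - h₄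

theorem gen_central (H : JordanCompat Δ δ) (H' : JordanCompat δ δ) (h : Peirce e f) (a : A) :
    Δ 1 * a = a * Δ 1 := by
  have h₁ := H.gen_offdiag H' h
  have h₂ := H.gen_offdiag H' h.symm
  have key : ∀ p q : A, Peirce p q → q * Δ 1 * p = 0 → ∀ a,
      Δ 1 * (p * a * q) = p * a * q * Δ 1 := by
    intro p q h h₁ a
    have k := congrArg (fun t => p * t * q) (H.gen_comm H' h p (p * a * q))
    rw [h.mul_offdiag h₁, h.offdiag_mul h₁]
    simpa only [mul_sub, sub_mul, mul_assoc, h.rules, mul_zero, zero_mul, sub_zero, sub_eq_zero] using k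
  exact h.central h₁ h₂ (key e f h h₂) (key f e h.symm h₁) a

theorem gen_eq (H : JordanCompat Δ δ) (H' : JordanCompat δ δ) (h : Peirce e f) (y : A) :
    Δ y = Δ 1 * y + (δ y - δ 1 * y) := by
  apply h.two_inj
  have := H.map_eq H' h y
  rw [← H.gen_central H' h] at this
  linear_combination (norm := abel) this

end JordanCompat

/-- A multiplicative Jordan derivation that doubles correctly and vanishes on `e`. -/
structure NormalizedJordan {A : Type*} [Ring A] (e : A) (δ : A → A) : Prop where
  jordan : ∀ x y, δ (x * y + y * x) = δ x * y + y * δ x + (x * δ y + δ y * x)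
  double : ∀ x, δ (x + x) = δ x + δ x
  map_idem : δ e = 0

namespace NormalizedJordan

variable {A : Type*} [Ring A] {e f : A} {δ : A → A}

theorem map_zero (H : NormalizedJordan e δ) : δ 0 = 0 := by
  simpa using H.jordan 0 0

theorem map_one (H : NormalizedJordan e δ) (h : Peirce e f) : δ 1 = 0 := by
  have := H.jordan 1 1
  simp only [mul_one, one_mul, H.double] at this
  exact h.two _ (by linear_combination (norm := abel) -this)

theorem map_compl (H : NormalizedJordan e δ) (h : Peirce e f) : δ f = 0 := by
  have h₁ := H.jordan e f
  have h₂ := H.jordan f f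
  simp only [h.ef, h.fe, add_zero, H.map_zero, H.map_idem, zero_mul, mul_zero, zero_add] at h₁
  have h₄ : e * δ f * e = 0 := by
    apply h.two
    have h' := congrArg (fun t => e * t * e) h₁
    simp only [mul_add, add_mul, mul_assoc, h.rules, mul_zero, zero_mul] at h' ⊢
    exact h'.symm
  have h₅ : e * δ f * f = 0 := by
    have := congrArg (fun t => e * t * f) h₁
    simp only [mul_add, add_mul, mul_assoc, h.rules, mul_zero, zero_mul, add_zero] at this ⊢
    exact this.symm
  have h₆ : f * δ f * e = 0 := by
    have := congrArg (fun t => f * t * e) h₁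
    simp only [mul_add, add_mul, mul_assoc, h.rules, mul_zero, zero_mul, zero_add] at this ⊢
    exact this.symm
  have h₇ : f * δ f * f = 0 := by
    apply h.two
    have := congrArg (fun t => f * t * f) h₂
    simp only [mul_add, add_mul, mul_assoc, h.rules, H.double] at this ⊢
    linear_combination (norm := abel) -this
  rw [h.decomp (δ f), h₄, h₅, h₆, h₇]
  simp

theorem symm (H : NormalizedJordan e δ) (h : Peirce e f) : NormalizedJordan f δ :=
  ⟨H.jordan, H.double, H.map_compl h⟩

theorem map_sub_idem (H : NormalizedJordan e δ) (h : Peirce e f) : δ (e - f) = 0 := by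
  have h₁ := H.jordan e (e - f)
  have h₂ := H.jordan (e - f) (e - f)
  have a₁ : e * (e - f) + (e - f) * e = e + e := by
    simp only [mul_sub, sub_mul, h.rules, sub_zero]
  have a₂ : (e - f) * (e - f) + (e - f) * (e - f) = 1 + 1 := by
    simp only [mul_sub, sub_mul, h.rules, sub_zero, zero_sub, ← h.add_eq]
    abel
  rw [a₁, H.double, H.map_idem] at h₁
  rw [a₂, H.double, H.map_one h] at h₂
  apply h.ext
  · apply h.two_inj
    have := congrArg (fun t => e * t * e) h₁
    simp only [mul_add, add_mul, mul_assoc, h.rules, mul_zero, zero_mul, add_zero, zero_add] at this ⊢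
    exact this.symm
  · have := congrArg (fun t => e * t * f) h₁
    simp only [mul_add, add_mul, mul_assoc, h.rules, mul_zero, zero_mul, add_zero, zero_add] at this ⊢
    exact this.symm
  · have := congrArg (fun t => f * t * e) h₁
    simp only [mul_add, add_mul, mul_assoc, h.rules, mul_zero, zero_mul, add_zero, zero_add] at this ⊢
    exact this.symm
  · apply h.two_inj
    apply h.two_inj
    have := congrArg (fun t => f * t * f) h₂
    simp only [mul_add, add_mul, mul_sub, sub_mul, mul_assoc, h.rules, mul_zero, zero_mul, add_zero,
      zero_sub, neg_mul] at this ⊢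
    linear_combination (norm := abel) this

theorem corner (H : NormalizedJordan e δ) (h : Peirce e f) (x : A) :
    δ (e * x * e) = e * δ x * e := by
  have h₁ := H.jordan x (e - f)
  have a₁ : x * (e - f) + (e - f) * x = (e * x * e - f * x * f) + (e * x * e - f * x * f) := by
    apply h.ext <;> simp only [mul_add, add_mul, mul_sub, sub_mul, mul_assoc, h.rules, mul_zero, zero_mul, sub_zero, zero_sub, neg_mul, mul_neg, neg_zero] <;> abel
  have h₂ := H.jordan (e * x * e - f * x * f) e
  have a₂ : (e * x * e - f * x * f) * e + e * (e * x * e - f * x * f) = e * x * e + e * x * e := by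
    simp only [mul_sub, sub_mul, mul_assoc, h.rules, mul_zero, sub_zero]
  rw [a₁, H.double, H.map_sub_idem h] at h₁
  rw [a₂, H.double, H.map_idem] at h₂
  have h₃ : δ (e * x * e - f * x * f) = e * δ x * e - f * δ x * f := by
    apply h.two_inj
    rw [h₁]
    apply h.ext <;> simp only [mul_add, add_mul, mul_sub, sub_mul, mul_assoc, h.rules, mul_zero, zero_mul, sub_zero, zero_sub, neg_mul, mul_neg, neg_zero] <;> abel
  apply h.two_inj
  rw [h₂, h₃]
  simp only [mul_add, add_mul, mul_sub, sub_mul, mul_assoc, h.rules, mul_zero, zero_mul, sub_zero, add_zero]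

theorem offdiag (H : NormalizedJordan e δ) (h : Peirce e f) (x : A) :
    δ (e * x * f + f * x * e) = e * δ x * f + f * δ x * e := by
  have h₁ := H.jordan x e
  have h₂ := H.jordan (x * e + e * x) f
  rw [h₁, H.map_idem, H.map_compl h] at h₂
  have a₁ : (x * e + e * x) * f + f * (x * e + e * x) = e * x * f + f * x * e := by
    simp only [mul_add, add_mul, mul_assoc, h.rules, mul_zero, zero_add, add_zero]
  rw [← a₁, h₂]
  simp only [mul_add, add_mul, mul_assoc, h.rules, mul_zero, zero_mul, zero_add, add_zero]

theorem offdiag_add (H : NormalizedJordan e δ) (h : Peirce e f) (x y : A) :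
    δ (e * (x + y) * f + f * (x + y) * e) =
      δ (e * x * f + f * x * e) + δ (e * y * f + f * y * e) := by
  have aux : ∀ p q : A, ∀ h : Peirce p q, NormalizedJordan p δ → ∀ z,
      δ (p + (p * z * q + q * z * p)) = p * δ z * q + q * δ z * p := by
    intro p q h H z
    have h₁ := (H.corner h (p + (p * z * q + q * z * p))).symm
    have h₂ := ((H.symm h).corner h.symm (p + (p * z * q + q * z * p))).symm
    have h₃ := (H.offdiag h (p + (p * z * q + q * z * p))).symm
    simp only [mul_add, add_mul, mul_assoc, h.rules, mul_zero, zero_add, add_zero, H.map_zero,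
      H.map_idem] at h₁ h₂ h₃
    have h₄ := H.offdiag h z
    rw [h.decomp (δ (p + (p * z * q + q * z * p)))]
    simp only [mul_add, add_mul, mul_assoc] at h₁ h₂ h₃ h₄ ⊢
    linear_combination (norm := abel) h₁ + h₂ + h₃ + h₄
  have h₁ := H.offdiag h ((e + (e * x * f + f * x * e)) * (f + (f * y * e + e * y * f)) +
    (f + (f * y * e + e * y * f)) * (e + (e * x * f + f * x * e)))
  rw [H.jordan, aux e f h H, aux f e h.symm (H.symm h)] at h₁
  rw [H.offdiag h x, H.offdiag h y]
  simp only [mul_add, add_mul, mul_assoc, h.rules, mul_zero, zero_add, add_zero] at h₁ ⊢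
  rw [add_comm (f * (y * e))] at h₁
  rw [h₁]
  abel

theorem map_add (H : NormalizedJordan e δ) (h : Peirce e f) (x y : A) :
    δ (x + y) = δ x + δ y := by
  have diag : ∀ p q : A, ∀ h : Peirce p q, NormalizedJordan p δ →
      p * (δ (x + y) - δ x - δ y) * p = 0 := by
    intro p q h H
    apply h.faithful₁
    · intro a
      have h₁ := H.jordan (p * (x + y) * p) (p * a * q)
      have h₂ := H.jordan (p * x * p) (p * a * q)
      have h₃ := H.jordan (p * y * p) (p * a * q)
      have h₄ := H.offdiag_add h (p * x * p * a * q) (p * y * p * a * q)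
      rw [H.corner h] at h₁ h₂ h₃
      replace h₁ := congrArg (fun t => p * t * q) h₁
      replace h₂ := congrArg (fun t => p * t * q) h₂
      replace h₃ := congrArg (fun t => p * t * q) h₃
      replace h₄ := congrArg (fun t => p * t * q) h₄
      simp only [mul_add, add_mul, mul_sub, sub_mul, mul_assoc, h.rules, mul_zero, zero_mul,
        add_zero, zero_add] at h₁ h₂ h₃ h₄ ⊢
      linear_combination (norm := abel) h₂ + h₃ - h₁ + h₄
    · intro a
      have h₁ := H.jordan (p * (x + y) * p) (q * a * p)
      have h₂ := H.jordan (p * x * p) (q * a * p)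
      have h₃ := H.jordan (p * y * p) (q * a * p)
      have h₄ := H.offdiag_add h (q * a * p * x * p) (q * a * p * y * p)
      rw [H.corner h] at h₁ h₂ h₃
      replace h₁ := congrArg (fun t => q * t * p) h₁
      replace h₂ := congrArg (fun t => q * t * p) h₂
      replace h₃ := congrArg (fun t => q * t * p) h₃
      replace h₄ := congrArg (fun t => q * t * p) h₄
      simp only [mul_add, add_mul, mul_sub, sub_mul, mul_assoc, h.rules, mul_zero, zero_mul,
        add_zero, zero_add] at h₁ h₂ h₃ h₄ ⊢
      linear_combination (norm := abel) h₂ + h₃ - h₁ + h₄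
  have off := H.offdiag_add h x y
  simp only [H.offdiag h] at off
  have d₁ := diag e f h H
  have d₂ := diag f e h.symm (H.symm h)
  rw [← sub_eq_zero, ← sub_sub, h.decomp (δ (x + y) - δ x - δ y), d₁, d₂]
  simp only [mul_add, add_mul, mul_sub, sub_mul] at off ⊢
  linear_combination (norm := abel) off

end NormalizedJordan

namespace NormalizedJordan

variable {A : Type*} [Ring A] {e f : A} {δ : A → A}

theorem corner_assoc (H : NormalizedJordan e δ) (h : Peirce e f) (x : A) :
    δ (e * (x * e)) = e * (δ x * e) := by
  simpa only [mul_assoc] using H.corner h x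

theorem corner_mul_offdiag (H : NormalizedJordan e δ) (h : Peirce e f) (x y : A) :
    e * (δ (e * (x * (e * (y * f)))) * f) =
        e * (δ x * (e * (y * f))) + e * (x * (e * (δ (e * (y * f)) * f))) ∧
      f * (δ (e * (x * (e * (y * f)))) * e) = f * (δ (e * (y * f)) * (e * (x * e))) := by
  have k := H.jordan (e * x * e) (e * y * f)
  have k₁ := congrArg (fun t => e * t * f) k
  have k₂ := congrArg (fun t => f * t * e) k
  simp only [mul_add, add_mul, mul_assoc, h.rules, H.corner_assoc h, mul_zero, zero_mul, add_zero,
    zero_add] at k₁ k₂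
  exact ⟨k₁, k₂⟩

theorem offdiag_mul_corner (H : NormalizedJordan e δ) (h : Peirce e f) (x y : A) :
    e * (δ (e * (x * (f * (y * f)))) * f) =
        e * (δ (e * (x * f)) * (f * (y * f))) + e * (x * (f * (δ y * f))) ∧
      f * (δ (e * (x * (f * (y * f)))) * e) = f * (y * (f * (δ (e * (x * f)) * e))) := by
  have k := H.jordan (e * x * f) (f * y * f)
  have k₁ := congrArg (fun t => e * t * f) k
  have k₂ := congrArg (fun t => f * t * e) k
  simp only [mul_add, add_mul, mul_assoc, h.rules, (H.symm h).corner_assoc h.symm, mul_zero,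
    zero_mul, add_zero, zero_add] at k₁ k₂
  exact ⟨k₁, k₂⟩

theorem offdiag_mul_offdiag (H : NormalizedJordan e δ) (h : Peirce e f) (x y : A) :
    e * (δ (e * (x * (f * (y * e)))) * e) =
        e * (δ (e * (x * f)) * (f * (y * e))) + e * (x * (f * (δ (f * (y * e)) * e))) := by
  have k := congrArg (fun t => e * t * e) (H.jordan (e * x * f) (f * y * e))
  have k₁ := (H.symm h).corner_assoc h.symm (y * e * x)
  simp only [mul_add, add_mul, mul_assoc, h.rules, H.map_add h, mul_zero, zero_mul, add_zero,
    zero_add] at k k₁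
  simpa only [k₁, mul_assoc, h.rules, zero_mul, mul_zero, add_zero] using k

theorem offdiag_cancel (H : NormalizedJordan e δ) (h : Peirce e f) (x y : A) :
    e * (x * (f * (δ (e * (y * f)) * e))) + e * (y * (f * (δ (e * (x * f)) * e))) = 0 ∧
      f * (δ (e * (x * f)) * (e * (y * f))) + f * (δ (e * (y * f)) * (e * (x * f))) = 0 := by
  have k := H.jordan (e * x * f) (e * y * f)
  have k₁ := congrArg (fun t => e * t * e) k
  have k₂ := congrArg (fun t => f * t * f) k
  simp only [mul_add, add_mul, mul_assoc, h.rules, H.map_zero, mul_zero, zero_mul, add_zero,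
    zero_add] at k₁ k₂
  exact ⟨by rw [add_comm]; exact k₁.symm, k₂.symm⟩

theorem corner_mul_corner (H : NormalizedJordan e δ) (h : Peirce e f) (x y : A) :
    e * (δ (e * (x * (e * (y * e)))) * e) =
      e * (δ x * (e * (y * e))) + e * (x * (e * (δ y * e))) := by
  have key : e * (δ (e * x * e * y * e) - δ x * e * y - x * e * δ y) * e = 0 := by
    apply h.faithful₁
    · intro a
      have k₁ := (H.corner_mul_offdiag h (x * e * y) a).1
      have k₂ := (H.corner_mul_offdiag h x (y * e * a)).1
      have k₃ := congrArg (e * x * ·) (H.corner_mul_offdiag h y a).1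
      have k₄ := H.corner h (x * e * y)
      rw [show e * x * e * y * e = e * (x * e * y) * e by simp only [mul_assoc], k₄]
      simp only [mul_add, mul_sub, sub_mul, mul_assoc, h.rules] at k₁ k₂ k₃ ⊢
      linear_combination (norm := abel) k₂ - k₁ + k₃
    · intro a
      have k₁ := ((H.symm h).offdiag_mul_corner h.symm a (x * e * y)).1
      have k₂ := ((H.symm h).offdiag_mul_corner h.symm (a * e * x) y).1
      have k₃ := congrArg (· * (y * e)) ((H.symm h).offdiag_mul_corner h.symm a x).1
      have k₄ := H.corner h (x * e * y)
      rw [show e * x * e * y * e = e * (x * e * y) * e by simp only [mul_assoc], k₄]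
      simp only [mul_sub, add_mul, sub_mul, mul_assoc, h.rules] at k₁ k₂ k₃ ⊢
      linear_combination (norm := abel) k₂ - k₁ + k₃
  simp only [mul_sub, sub_mul, mul_assoc] at key
  linear_combination (norm := abel) key

/-- The part of `δ` exchanging the off-diagonal corners. -/
def swapPart (e f : A) (δ : A → A) (x : A) : A :=
  f * δ (e * x * f) * e + e * δ (f * x * e) * f

/-- The part of `δ` preserving the Peirce corners. -/
def diagPart (e f : A) (δ : A → A) (x : A) : A :=
  e * δ (e * x * e) * e + e * δ (e * x * f) * f + f * δ (f * x * e) * e + f * δ (f * x * f) * f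

theorem eq_diagPart_add_swapPart (H : NormalizedJordan e δ) (h : Peirce e f) (x : A) :
    δ x = diagPart e f δ x + swapPart e f δ x := by
  have k := congrArg δ (h.decomp x)
  have k₁ := H.offdiag h (e * x * f)
  have k₂ := H.offdiag h (f * x * e)
  rw [H.map_add h, H.map_add h, H.map_add h, H.corner h, (H.symm h).corner h.symm] at k
  unfold diagPart swapPart
  rw [H.corner h, (H.symm h).corner h.symm]
  simp only [mul_assoc, h.rules, mul_zero, zero_mul, zero_add, add_zero] at k k₁ k₂ ⊢
  linear_combination (norm := abel) k + k₁ + k₂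

theorem diagPart_add (H : NormalizedJordan e δ) (h : Peirce e f) (x y : A) :
    diagPart e f δ (x + y) = diagPart e f δ x + diagPart e f δ y := by
  simp only [diagPart, mul_add, add_mul, H.map_add h]
  abel

theorem swapPart_add (H : NormalizedJordan e δ) (h : Peirce e f) (x y : A) :
    swapPart e f δ (x + y) = swapPart e f δ x + swapPart e f δ y := by
  simp only [swapPart, mul_add, add_mul, H.map_add h]
  abel

theorem _root_.Peirce.mul_split (h : Peirce e f) (x y : A) :
    x * y = x * (e * y) + x * (f * y) := by
  rw [← mul_add, ← add_mul, h.add_eq, one_mul]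

theorem diagPart_comp₁₁ (H : NormalizedJordan e δ) (h : Peirce e f) (x y : A) :
    e * diagPart e f δ (x * y) * e =
      e * (diagPart e f δ x * y + x * diagPart e f δ y) * e := by
  have k₁ := H.corner_mul_corner h x y
  have k₂ := H.offdiag_mul_offdiag h x y
  rw [h.mul_split x y]
  simp only [diagPart, mul_add, add_mul, mul_assoc, h.rules, H.map_add h, mul_zero, zero_add,
    add_zero, H.corner_assoc h, k₁, k₂]
  abel

theorem diagPart_comp₁₂ (H : NormalizedJordan e δ) (h : Peirce e f) (x y : A) :
    e * diagPart e f δ (x * y) * f =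
      e * (diagPart e f δ x * y + x * diagPart e f δ y) * f := by
  have k₁ := (H.corner_mul_offdiag h x y).1
  have k₂ := (H.offdiag_mul_corner h x y).1
  rw [h.mul_split x y]
  simp only [diagPart, mul_add, add_mul, mul_assoc, h.rules, H.map_add h, mul_zero, zero_add,
    add_zero, H.corner_assoc h, (H.symm h).corner_assoc h.symm, k₁, k₂]
  abel

theorem diagPart_symm (x : A) : diagPart f e δ x = diagPart e f δ x := by
  unfold diagPart
  abel

theorem swapPart_symm (x : A) : swapPart f e δ x = swapPart e f δ x :=
  add_comm _ _

theorem diagPart_mul (H : NormalizedJordan e δ) (h : Peirce e f) (x y : A) :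
    diagPart e f δ (x * y) = diagPart e f δ x * y + x * diagPart e f δ y := by
  refine h.ext (H.diagPart_comp₁₁ h x y) (H.diagPart_comp₁₂ h x y) ?_ ?_
  · simpa only [diagPart_symm] using (H.symm h).diagPart_comp₁₂ h.symm x y
  · simpa only [diagPart_symm] using (H.symm h).diagPart_comp₁₁ h.symm x y

theorem swapPart_comp₁₁ (H : NormalizedJordan e δ) (h : Peirce e f) (x y : A) :
    e * swapPart e f δ (x * y + y * x) * e =
      e * (swapPart e f δ x * y + y * swapPart e f δ x + x * swapPart e f δ y +
        swapPart e f δ y * x) * e := by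
  have k₁ := (H.offdiag_cancel h x y).1
  have k₂ := ((H.symm h).offdiag_cancel h.symm x y).2
  simp only [swapPart, mul_add, add_mul, mul_assoc, h.rules, H.map_add h, mul_zero, zero_add,
    add_zero]
  linear_combination (norm := abel) -k₁ - k₂

theorem swapPart_comp₁₂ (H : NormalizedJordan e δ) (h : Peirce e f) (x y : A) :
    e * swapPart e f δ (x * y + y * x) * f =
      e * (swapPart e f δ x * y + y * swapPart e f δ x + x * swapPart e f δ y +
        swapPart e f δ y * x) * f := by
  have k₁ := fun x y => ((H.symm h).corner_mul_offdiag h.symm x y).2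
  have k₂ := fun x y => ((H.symm h).offdiag_mul_corner h.symm x y).2
  rw [h.mul_split x y, h.mul_split y x]
  simp only [swapPart, mul_add, add_mul, mul_assoc, h.rules, H.map_add h, mul_zero, zero_add,
    add_zero, k₁, k₂]
  abel

theorem swapPart_jordan (H : NormalizedJordan e δ) (h : Peirce e f) (x y : A) :
    swapPart e f δ (x * y + y * x) =
      swapPart e f δ x * y + y * swapPart e f δ x + x * swapPart e f δ y +
        swapPart e f δ y * x := by
  refine h.ext (H.swapPart_comp₁₁ h x y) (H.swapPart_comp₁₂ h x y) ?_ ?_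
  · simpa only [swapPart_symm] using (H.symm h).swapPart_comp₁₂ h.symm x y
  · simpa only [swapPart_symm] using (H.symm h).swapPart_comp₁₁ h.symm x y

theorem isSingularJordanDeriv_swapPart (H : NormalizedJordan e δ) (h : Peirce e (1 - e)) :
    IsSingularJordanDeriv e (swapPart e (1 - e) δ) := by
  have z := H.map_zero
  refine ⟨H.swapPart_add h, H.swapPart_jordan h, fun a => ?_,
    fun a => ⟨δ (e * a * (1 - e)), ?_⟩, fun a => ⟨δ ((1 - e) * a * e), ?_⟩, fun a => ?_⟩ <;>
  · generalize 1 - e = f at *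
    simp only [swapPart, mul_assoc, h.rules, z, mul_zero, zero_mul, add_zero, zero_add]

end NormalizedJordan

namespace JordanCompat

variable {A : Type*} [Ring A] {e f : A} {δ : A → A}

/-- Correcting by a central multiple and an inner derivation normalizes a Jordan-compatible map. -/
theorem normalizedJordan (H : JordanCompat δ δ) (h : Peirce e f) :
    ∃ s, NormalizedJordan e fun y => δ y - δ 1 * y - (y * s - s * y) := by
  refine ⟨e * δ e * f - f * δ e * e, fun x y => ?_, fun x => ?_, ?_⟩
  · have k := H.map_jordan H h x y
    have hc := H.one_central h
    have k₁ : ∀ a b, a * (δ 1 * b) = δ 1 * (a * b) := fun a b => by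
      rw [← mul_assoc, ← hc, mul_assoc]
    generalize e * δ e * f - f * δ e * e = s
    simp only [mul_add, add_mul, mul_sub, sub_mul, mul_assoc, k₁] at k ⊢
    linear_combination (norm := abel) k
  · simp only [H.map_double H h, mul_add, add_mul]
    abel
  · have k₁ := H.idem_corner₁ h
    have k₂ := H.idem_corner₂ h
    have k₃ := H.one_offdiag h.symm
    apply h.ext <;>
    · simp only [mul_sub, sub_mul, mul_assoc, h.rules, mul_zero, zero_mul] at k₁ k₂ k₃ ⊢
      simp [k₁, k₂, k₃]

end JordanCompat

/-- On a 2-torsion-free unital ring with a nontrivial idempotent satisfying (♠), every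
multiplicative generalized Jordan `n`-derivation has the form `Δ(t) = μt + d(t) + φ(t)`
with `μ` central, `d` a derivation and `φ` a singular Jordan derivation. -/
theorem stmt_4 {A : Type*} [Ring A] (n : ℕ) (hn : 2 ≤ n)
    (h2 : ∀ t : A, 2 * t = 0 → t = 0)
    (e₁ : A) (hidem : e₁ * e₁ = e₁) (he0 : e₁ ≠ 0) (he1 : e₁ ≠ 1)
    (hsp : Spade e₁)
    (Δ δ₀ : A → A) (hδ₀ : IsMulJordanDeriv n δ₀) (hΔ : IsMulGenJordanDeriv n Δ δ₀) :
    ∃ μ : A, ∃ d φ : A → A,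
      (∀ a : A, μ * a = a * μ) ∧
      (∀ x y : A, d (x + y) = d x + d y) ∧
      (∀ x y : A, d (x * y) = d x * y + x * d y) ∧
      IsSingularJordanDeriv e₁ φ ∧
      ∀ t : A, Δ t = μ * t + d t + φ t := by
  have hf : e₁ + (1 - e₁) = 1 := add_sub_cancel _ _
  have h : Peirce e₁ (1 - e₁) := by
    refine ⟨hf, hidem, ?_, ?_, ?_, fun t ht => h2 t (by rw [two_mul, ht]),
      fun t k₁ k₂ => hsp.1 t fun a => ⟨?_, ?_⟩, fun t k₁ k₂ => hsp.2 t fun a => ⟨?_, ?_⟩⟩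
    · simp [mul_sub, sub_mul, hidem]
    · simp [mul_sub, hidem]
    · simp [sub_mul, hidem]
    · rw [← k₁ a, ← mul_assoc, ← mul_assoc, mul_assoc _ e₁ e₁, hidem]
    · rw [← k₂ a, ← mul_assoc, ← mul_assoc, mul_assoc _ e₁ e₁, hidem]
    · rw [← k₂ a]
      have ff : (1 - e₁) * (1 - e₁) = 1 - e₁ := by simp [mul_sub, sub_mul, hidem]
      rw [← mul_assoc, ← mul_assoc, mul_assoc _ (1 - e₁) (1 - e₁), ff]
    · rw [← k₁ a]
      have ff : (1 - e₁) * (1 - e₁) = 1 - e₁ := by simp [mul_sub, sub_mul, hidem]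
      rw [← mul_assoc, ← mul_assoc, mul_assoc _ (1 - e₁) (1 - e₁), ff]
  have H := hΔ.jordanCompat hn h2
  have H' := (hδ₀.isMulGenJordanDeriv hn).jordanCompat hn h2
  obtain ⟨s, N⟩ := H'.normalizedJordan h
  set δ := fun y => δ₀ y - δ₀ 1 * y - (y * s - s * y)
  refine ⟨Δ 1, fun y => NormalizedJordan.diagPart e₁ (1 - e₁) δ y + (y * s - s * y), _,
    H.gen_central H' h, fun x y => ?_, fun x y => ?_, N.isSingularJordanDeriv_swapPart h,
    fun t => ?_⟩
  · simp only [N.diagPart_add h]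
    noncomm_ring
  · simp only [N.diagPart_mul h]
    noncomm_ring
  · have k := N.eq_diagPart_add_swapPart h t
    rw [H.gen_eq H' h]
    linear_combination (norm := (simp only [δ]; abel)) k
end
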